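/- arXiv:1510.01831 — 4 statements merged into one kernel-verified Lean document; each statement's English description precedes it below -/
import Mathlib

section
/- Let H be an m×m block tridiagonal matrix and let u, f be block vectors with H u = f, and let v = χ_{[a,b]} u. Then for every block row p, (H v)_p = [a ≤ p ≤ b] f_p − [p = a] H_{a,a−1} u_{a−1} − [p = b] H_{b,b+1} u_{b+1} + [p = a−1] H_{a−1,a} u_a + [p = b+1] H_{b+1,b} u_b. (In other words, the truncated wavefield satisfies the original equation inside the layer up to four boundary-supported correction sources.) -/
open Matrix Finset

/-- Restricting the column index of a tridiagonal array to `[a, b]` agrees with restricting the row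
index, up to the four entries coupling `[a, b]` to its complement. -/
theorem tridiagonal_ite_col_eq {M : Type*} [AddCommGroup M] (g : ℕ → ℕ → M) {a b p q : ℕ}
    (ha : 1 ≤ a) (hab : a ≤ b) (hg : p + 1 < q ∨ q + 1 < p → g p q = 0) :
    (if a ≤ q ∧ q ≤ b then g p q else 0) =
      (if a ≤ p ∧ p ≤ b then g p q else 0)
      - (if q = a - 1 then if p = a then g a (a - 1) else 0 else 0)
      - (if q = b + 1 then if p = b then g b (b + 1) else 0 else 0)
      + (if q = a then if p = a - 1 then g (a - 1) a else 0 else 0)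
      + (if q = b then if p = b + 1 then g (b + 1) b else 0 else 0) := by
  by_cases hfar : p + 1 < q ∨ q + 1 < p
  · have := hg hfar
    grind
  · obtain rfl | rfl | rfl : p = q ∨ p = q + 1 ∨ q = p + 1 := by omega
    all_goals grind

/-- If `H` is an `m×m` block tridiagonal matrix, `H u = f`, and
`v = χ_{[a,b]} u` with `1 ≤ a ≤ b ≤ m−2`, then for every block row `p`:
`(H v)_p = [a ≤ p ≤ b] f_p − [p=a] H_{a,a−1} u_{a−1} − [p=b] H_{b,b+1} u_{b+1}
 + [p=a−1] H_{a−1,a} u_a + [p=b+1] H_{b+1,b} u_b`. -/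
theorem truncated_solution_full_formula
    (m n : ℕ) (H : ℕ → ℕ → Matrix (Fin n) (Fin n) ℂ)
    (u f v : ℕ → Fin n → ℂ)
    (htri : ∀ p q, p < m → q < m → (p + 1 < q ∨ q + 1 < p) → H p q = 0)
    (hHu : ∀ p, p < m → ∑ q ∈ Finset.range m, H p q *ᵥ u q = f p)
    (a b : ℕ) (ha : 1 ≤ a) (hab : a ≤ b) (hb : b + 2 ≤ m)
    (hv : ∀ p, v p = if a ≤ p ∧ p ≤ b then u p else 0) :
    ∀ p, p < m →
      ∑ q ∈ Finset.range m, H p q *ᵥ v q =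
        (if a ≤ p ∧ p ≤ b then f p else 0)
        - (if p = a then H a (a - 1) *ᵥ u (a - 1) else 0)
        - (if p = b then H b (b + 1) *ᵥ u (b + 1) else 0)
        + (if p = a - 1 then H (a - 1) a *ᵥ u a else 0)
        + (if p = b + 1 then H (b + 1) b *ᵥ u b else 0) := by
  intro p hp
  have hterm : ∀ q ∈ Finset.range m, H p q *ᵥ v q =
      if a ≤ q ∧ q ≤ b then H p q *ᵥ u q else 0 := by
    intro q _
    rw [hv]
    split_ifs <;> simp
  have hcol : ∀ q ∈ Finset.range m, _ := fun q hq =>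
    tridiagonal_ite_col_eq (fun i j => H i j *ᵥ u j) (p := p) (q := q) ha hab fun hfar => by
      simp [htri p q hp (Finset.mem_range.mp hq) hfar]
  rw [Finset.sum_congr rfl hterm, Finset.sum_congr rfl hcol]
  have hmem : a - 1 < m ∧ b + 1 < m ∧ a < m ∧ b < m := by omega
  simp only [Finset.sum_add_distrib, Finset.sum_sub_distrib, Finset.sum_ite_eq',
    Finset.mem_range, hmem, if_true]
  rw [← hHu p hp]
  split_ifs <;> simp
end

section
/- Let H be an m×m block tridiagonal matrix and let u, f be block vectors with H u = f. Let B be any m×m block tridiagonal matrix that agrees with H on the extended layer [a−1, b+1], and let v = χ_{[a,b]} u. Then B v equals the boundary-corrected local source g; that is, for every block row p, (B v)_p = [a ≤ p ≤ b] f_p − [p = a] B_{a,a−1} u_{a−1} − [p = b] B_{b,b+1} u_{b+1} + [p = a−1] B_{a−1,a} u_a + [p = b+1] B_{b+1,b} u_b. (This is the discrete analogue of the fact that the Green's representation formula remains valid with any local Green's function consistent with the global operator on the layer.) -/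
open Matrix Finset

/-- If `H` is an `m×m` block tridiagonal matrix, `H u = f`, `B` is any
`m×m` block tridiagonal matrix agreeing with `H` on the extended layer `[a−1,b+1]`,
and `v = χ_{[a,b]} u` with `1 ≤ a ≤ b ≤ m−2`, then `B v` equals the
boundary-corrected local source: for every block row `p`,
`(B v)_p = [a ≤ p ≤ b] f_p − [p=a] B_{a,a−1} u_{a−1} − [p=b] B_{b,b+1} u_{b+1}
 + [p=a−1] B_{a−1,a} u_a + [p=b+1] B_{b+1,b} u_b`. -/
theorem local_operator_truncated_solution
    (m n : ℕ) (H B : ℕ → ℕ → Matrix (Fin n) (Fin n) ℂ)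
    (u f v : ℕ → Fin n → ℂ)
    (htriH : ∀ p q, p < m → q < m → (p + 1 < q ∨ q + 1 < p) → H p q = 0)
    (htriB : ∀ p q, p < m → q < m → (p + 1 < q ∨ q + 1 < p) → B p q = 0)
    (hHu : ∀ p, p < m → ∑ q ∈ Finset.range m, H p q *ᵥ u q = f p)
    (a b : ℕ) (ha : 1 ≤ a) (hab : a ≤ b) (hb : b + 2 ≤ m)
    (hagree : ∀ p q, a - 1 ≤ p → p ≤ b + 1 → a - 1 ≤ q → q ≤ b + 1 → B p q = H p q)
    (hv : ∀ p, v p = if a ≤ p ∧ p ≤ b then u p else 0) :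
    ∀ p, p < m →
      ∑ q ∈ Finset.range m, B p q *ᵥ v q =
        (if a ≤ p ∧ p ≤ b then f p else 0)
        - (if p = a then B a (a - 1) *ᵥ u (a - 1) else 0)
        - (if p = b then B b (b + 1) *ᵥ u (b + 1) else 0)
        + (if p = a - 1 then B (a - 1) a *ᵥ u a else 0)
        + (if p = b + 1 then B (b + 1) b *ᵥ u b else 0) := by
  intro p hp
  have entry : ∀ q ∈ Finset.range m, B p q *ᵥ v q =
      (if a ≤ p ∧ p ≤ b then H p q *ᵥ u q else 0)
      - (if q = a - 1 then (if p = a then B a (a - 1) *ᵥ u (a - 1) else 0) else 0)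
      - (if q = b + 1 then (if p = b then B b (b + 1) *ᵥ u (b + 1) else 0) else 0)
      + (if q = a then (if p = a - 1 then B (a - 1) a *ᵥ u a else 0) else 0)
      + (if q = b then (if p = b + 1 then B (b + 1) b *ᵥ u b else 0) else 0) := by
    intro q hq
    have hq := Finset.mem_range.mp hq
    rw [hv]
    by_cases hfar : p + 1 < q ∨ q + 1 < p
    · rw [htriH p q hp hq hfar, htriB p q hp hq hfar]
      simp only [zero_mulVec, ite_self]
      split_ifs <;> first | omega | simp
    · by_cases hpab : a ≤ p ∧ p ≤ b
      · rw [← hagree p q (by omega) (by omega) (by omega) (by omega)]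
        split_ifs <;> first | omega | (subst_vars; simp)
      · split_ifs <;> first | omega | (subst_vars; simp)
  rw [Finset.sum_congr rfl entry]
  simp only [Finset.sum_add_distrib, Finset.sum_sub_distrib, Finset.sum_ite_eq',
    Finset.mem_range]
  rw [if_pos (by omega : a - 1 < m), if_pos (by omega : b + 1 < m),
    if_pos (by omega : a < m), if_pos (by omega : b < m), ← hHu p hp]
  split_ifs <;> simp
end

section
/- Let H be an m×m block tridiagonal matrix and let u, f be block vectors with H u = f. Let B be an m×m block tridiagonal matrix that agrees with H on the extended layer [a−1, b+1] and is invertible as an (mn)×(mn) complex matrix. Let g be the boundary-corrected local source, g_p = [a ≤ p ≤ b] f_p − [p = a] B_{a,a−1} u_{a−1} − [p = b] B_{b,b+1} u_{b+1} + [p = a−1] B_{a−1,a} u_a + [p = b+1] B_{b+1,b} u_b. Then the local solve reproduces the truncated global solution exactly: (B⁻¹ g)_p = u_p for all a ≤ p ≤ b, and (B⁻¹ g)_p = 0 for all p < a and p > b. -/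
open Matrix Finset

/-- Entrywise form of the commutator identity between a block tridiagonal matrix and a truncation. -/
theorem tridiagonal_mulVec_truncation {n m a b : ℕ} {H B : ℕ → ℕ → Matrix (Fin n) (Fin n) ℂ}
    (u : ℕ → Fin n → ℂ)
    (htriH : ∀ p q, p < m → q < m → (p + 1 < q ∨ q + 1 < p) → H p q = 0)
    (htriB : ∀ p q, p < m → q < m → (p + 1 < q ∨ q + 1 < p) → B p q = 0)
    (ha : 1 ≤ a)
    (hagree : ∀ p q, a - 1 ≤ p → p ≤ b + 1 → a - 1 ≤ q → q ≤ b + 1 → B p q = H p q)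
    {p q : ℕ} (hp : p < m) (hq : q < m) :
    B p q *ᵥ (if a ≤ q ∧ q ≤ b then u q else 0) =
      (if a ≤ p ∧ p ≤ b then H p q *ᵥ u q else 0)
      - (if q = a - 1 then if p = a ∧ a ≤ b then B a (a - 1) *ᵥ u (a - 1) else 0 else 0)
      - (if q = b + 1 then if p = b ∧ a ≤ b then B b (b + 1) *ᵥ u (b + 1) else 0 else 0)
      + (if q = a then if p = a - 1 ∧ a ≤ b then B (a - 1) a *ᵥ u a else 0 else 0)
      + (if q = b then if p = b + 1 ∧ a ≤ b then B (b + 1) b *ᵥ u b else 0 else 0) := by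
  by_cases hfar : p + 1 < q ∨ q + 1 < p
  · rw [htriB p q hp hq hfar, htriH p q hp hq hfar]
    have h₁ : ¬ (q = a - 1 ∧ p = a ∧ a ≤ b) := by omega
    have h₂ : ¬ (q = b + 1 ∧ p = b ∧ a ≤ b) := by omega
    have h₃ : ¬ (q = a ∧ p = a - 1 ∧ a ≤ b) := by omega
    have h₄ : ¬ (q = b ∧ p = b + 1 ∧ a ≤ b) := by omega
    simp only [← ite_and, h₁, h₂, h₃, h₄, if_false, zero_mulVec, ite_self, sub_zero, add_zero]
  · by_cases hP : a ≤ p ∧ p ≤ b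
    · have hBH : B p q = H p q := hagree p q (by omega) (by omega) (by omega) (by omega)
      have h₃ : ¬ (q = a ∧ p = a - 1 ∧ a ≤ b) := by omega
      have h₄ : ¬ (q = b ∧ p = b + 1 ∧ a ≤ b) := by omega
      simp only [← ite_and, h₃, h₄, if_false, add_zero, if_pos hP]
      by_cases hQ : a ≤ q ∧ q ≤ b
      · have h₁ : ¬ (q = a - 1 ∧ p = a ∧ a ≤ b) := by omega
        have h₂ : ¬ (q = b + 1 ∧ p = b ∧ a ≤ b) := by omega
        simp only [if_pos hQ, h₁, h₂, if_false, sub_zero, hBH]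
      · rw [if_neg hQ, mulVec_zero, ← hBH]
        rcases lt_or_ge q a with hqa | hqa
        · have h₂ : ¬ (q = b + 1 ∧ p = b ∧ a ≤ b) := by omega
          obtain rfl : p = a := by omega
          obtain rfl : q = p - 1 := by omega
          rw [if_neg h₂, if_pos ⟨rfl, rfl, hP.2⟩, sub_self, sub_zero]
        · have h₁ : ¬ (q = a - 1 ∧ p = a ∧ a ≤ b) := by omega
          obtain rfl : p = b := by omega
          obtain rfl : q = p + 1 := by omega
          rw [if_neg h₁, if_pos ⟨rfl, rfl, hP.1⟩, sub_zero, sub_self]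
    · have h₁ : ¬ (q = a - 1 ∧ p = a ∧ a ≤ b) := by omega
      have h₂ : ¬ (q = b + 1 ∧ p = b ∧ a ≤ b) := by omega
      simp only [← ite_and, h₁, h₂, if_false, sub_zero, if_neg hP, zero_add]
      by_cases hQ : a ≤ q ∧ q ≤ b
      · rw [if_pos hQ]
        rcases lt_or_ge p a with hpa | hpa
        · have h₄ : ¬ (q = b ∧ p = b + 1 ∧ a ≤ b) := by omega
          obtain rfl : q = a := by omega
          obtain rfl : p = q - 1 := by omega
          rw [if_neg h₄, if_pos ⟨rfl, rfl, hQ.2⟩, add_zero]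
        · have h₃ : ¬ (q = a ∧ p = a - 1 ∧ a ≤ b) := by omega
          obtain rfl : q = b := by omega
          obtain rfl : p = q + 1 := by omega
          rw [if_neg h₃, if_pos ⟨rfl, rfl, hQ.1⟩, zero_add]
      · have h₃ : ¬ (q = a ∧ p = a - 1 ∧ a ≤ b) := by omega
        have h₄ : ¬ (q = b ∧ p = b + 1 ∧ a ≤ b) := by omega
        simp only [if_neg hQ, h₃, h₄, if_false, mulVec_zero, add_zero]

/-- If `H` is an `m×m` block tridiagonal matrix, `H u = f`, `B` is an
`m×m` block tridiagonal matrix agreeing with `H` on the extended layer `[a−1,b+1]`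
and invertible as an `(mn)×(mn)` complex matrix, and `g` is the boundary-corrected
local source, then the local solve reproduces the truncated global solution exactly:
`(B⁻¹ g)_p = u_p` for `a ≤ p ≤ b` and `(B⁻¹ g)_p = 0` for `p < a` or `p > b`. -/
theorem local_solve_reproduces_truncation
    (m n : ℕ) (H B : ℕ → ℕ → Matrix (Fin n) (Fin n) ℂ)
    (u f : ℕ → Fin n → ℂ)
    (htriH : ∀ p q, p < m → q < m → (p + 1 < q ∨ q + 1 < p) → H p q = 0)
    (htriB : ∀ p q, p < m → q < m → (p + 1 < q ∨ q + 1 < p) → B p q = 0)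
    (hHu : ∀ p, p < m → ∑ q ∈ Finset.range m, H p q *ᵥ u q = f p)
    (a b : ℕ) (ha : 1 ≤ a) (hab : a ≤ b) (hb : b + 2 ≤ m)
    (hagree : ∀ p q, a - 1 ≤ p → p ≤ b + 1 → a - 1 ≤ q → q ≤ b + 1 → B p q = H p q)
    (Bmat : Matrix (Fin m × Fin n) (Fin m × Fin n) ℂ)
    (hBmat : ∀ (p q : Fin m) (i j : Fin n), Bmat (p, i) (q, j) = B (p : ℕ) (q : ℕ) i j)
    (hinv : IsUnit Bmat)
    (g : ℕ → Fin n → ℂ)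
    (hg : ∀ p, g p =
      (if a ≤ p ∧ p ≤ b then f p else 0)
      - (if p = a then B a (a - 1) *ᵥ u (a - 1) else 0)
      - (if p = b then B b (b + 1) *ᵥ u (b + 1) else 0)
      + (if p = a - 1 then B (a - 1) a *ᵥ u a else 0)
      + (if p = b + 1 then B (b + 1) b *ᵥ u b else 0)) :
    (∀ p : Fin m, a ≤ (p : ℕ) → (p : ℕ) ≤ b → ∀ i : Fin n,
      (Bmat⁻¹ *ᵥ fun pq => g (pq.1 : ℕ) pq.2) (p, i) = u (p : ℕ) i) ∧
    (∀ p : Fin m, ((p : ℕ) < a ∨ b < (p : ℕ)) → ∀ i : Fin n,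
      (Bmat⁻¹ *ᵥ fun pq => g (pq.1 : ℕ) pq.2) (p, i) = 0) := by
  have hrow : ∀ p, p < m →
      ∑ q ∈ Finset.range m, B p q *ᵥ (if a ≤ q ∧ q ≤ b then u q else 0) = g p := by
    intro p hp
    rw [Finset.sum_congr rfl fun q hq => tridiagonal_mulVec_truncation u htriH htriB ha hagree hp
      (Finset.mem_range.mp hq), hg p, ← hHu p hp]
    have h₁ : a - 1 < m := by omega
    have h₂ : b + 1 < m := by omega
    have h₃ : a < m := by omega
    have h₄ : b < m := by omega
    simp only [Finset.sum_add_distrib, Finset.sum_sub_distrib, Finset.sum_ite_eq',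
      Finset.mem_range, h₁, h₂, h₃, h₄, if_true, hab, and_true]
    split_ifs <;> simp only [Finset.sum_const_zero]
  set v : Fin m × Fin n → ℂ :=
    fun pq => (if a ≤ (pq.1 : ℕ) ∧ (pq.1 : ℕ) ≤ b then u pq.1 else 0 : Fin n → ℂ) pq.2 with hv
  have hmul : Bmat *ᵥ v = fun pq => g (pq.1 : ℕ) pq.2 := by
    ext ⟨p, i⟩
    rw [← hrow p p.2, Finset.sum_apply, Finset.sum_range]
    simp only [mulVec, dotProduct, Fintype.sum_prod_type, hBmat, hv]
  have hsol : (Bmat⁻¹ *ᵥ fun pq => g (pq.1 : ℕ) pq.2) = v := by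
    rw [← hmul, mulVec_mulVec, nonsing_inv_mul _ ((isUnit_iff_isUnit_det _).mp hinv), one_mulVec]
  rw [hsol]
  refine ⟨fun p hpa hpb i => ?_, fun p hp i => ?_⟩
  · simp only [hv, if_pos (And.intro hpa hpb)]
  · have hout : ¬ (a ≤ (p : ℕ) ∧ (p : ℕ) ≤ b) := by omega
    simp only [hv, if_neg hout, Pi.zero_apply]
end

section
/- Let H be an m×m block tridiagonal matrix and let u, f be block vectors with H u = f. Let B be an m×m block tridiagonal matrix that agrees with H on the extended layer [a−1, b+1] and is invertible, and write G_{j,k} ∈ ℂ^{n×n} for the (j,k) block of B⁻¹. Then for every j with a ≤ j ≤ b, the global solution inside the layer is recovered by the discrete Green's representation formula: u_j = Σ_{q=a}^{b} G_{j,q} f_q + G_{j,a−1} B_{a−1,a} u_a − G_{j,a} B_{a,a−1} u_{a−1} + G_{j,b+1} B_{b+1,b} u_b − G_{j,b} B_{b,b+1} u_{b+1}; that is, u_j equals the local Newton potential of the layer-restricted source plus the down-going and up-going incomplete Green's integrals built from the traces u_{a−1}, u_a, u_b, u_{b+1}. -/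
open Matrix Finset

namespace Matrix

/-- A left inverse of a block matrix, with blocks indexed by natural numbers below `m`, acts as a
left inverse on block vectors. -/
theorem sum_block_mulVec_of_mul_eq_one {m n : ℕ} {R : Type*} [CommRing R]
    {G B : ℕ → ℕ → Matrix (Fin n) (Fin n) R} {C D : Matrix (Fin m × Fin n) (Fin m × Fin n) R}
    (hC : ∀ (p q : Fin m) (i j : Fin n), G p q i j = C (p, i) (q, j))
    (hD : ∀ (p q : Fin m) (i j : Fin n), D (p, i) (q, j) = B p q i j)
    (h : C * D = 1) (v : ℕ → Fin n → R) {p : ℕ} (hp : p < m) :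
    ∑ q ∈ range m, G p q *ᵥ (∑ r ∈ range m, B q r *ᵥ v r) = v p := by
  set w : Fin m × Fin n → R := fun x => v x.1 x.2 with hw
  have hDw : ∀ (q : Fin m) (k : Fin n),
      (D *ᵥ w) (q, k) = (∑ r ∈ range m, B q r *ᵥ v r) k := fun q k => by
    simp [mulVec, dotProduct, Fintype.sum_prod_type, hD, hw, sum_range]
  have hCDw : C *ᵥ (D *ᵥ w) = w := by rw [mulVec_mulVec, h, one_mulVec]
  ext i
  have hpi := congrFun hCDw (⟨p, hp⟩, i)
  rw [mulVec, dotProduct, Fintype.sum_prod_type] at hpi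
  simp only [hDw, ← hC] at hpi
  rw [Finset.sum_apply, sum_range]
  exact hpi

/-- Truncating a block vector to the layer `[a, b]` before applying a block tridiagonal matrix,
entry by entry: inside the layer this removes the two couplings to the outside, and outside it
creates the two couplings to the layer. -/
theorem block_mulVec_truncate_layer {m n : ℕ} {R : Type*} [CommRing R]
    {H B : ℕ → ℕ → Matrix (Fin n) (Fin n) R}
    (htriH : ∀ p q, p < m → q < m → (p + 1 < q ∨ q + 1 < p) → H p q = 0)
    (htriB : ∀ p q, p < m → q < m → (p + 1 < q ∨ q + 1 < p) → B p q = 0)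
    {a b : ℕ} (ha : 1 ≤ a) (hab : a ≤ b)
    (hagree : ∀ p q, a - 1 ≤ p → p ≤ b + 1 → a - 1 ≤ q → q ≤ b + 1 → B p q = H p q)
    (u : ℕ → Fin n → R) {p q : ℕ} (hp : p < m) (hq : q < m) :
    B p q *ᵥ (if q ∈ Icc a b then u q else 0) =
      (if p ∈ Icc a b then H p q *ᵥ u q else 0)
        + (if p = a - 1 then if q = a then B (a - 1) a *ᵥ u a else 0 else 0)
        - (if p = a then if q = a - 1 then B a (a - 1) *ᵥ u (a - 1) else 0 else 0)
        + (if p = b + 1 then if q = b then B (b + 1) b *ᵥ u b else 0 else 0)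
        - (if p = b then if q = b + 1 then B b (b + 1) *ᵥ u (b + 1) else 0 else 0) := by
  have hfar : p + 1 < q ∨ q + 1 < p → B p q = 0 ∧ H p q = 0 := fun h =>
    ⟨htriB p q hp hq h, htriH p q hp hq h⟩
  have hnear := hagree p q
  by_cases hd : p + 1 < q ∨ q + 1 < p
  · rw [(hfar hd).1, (hfar hd).2]
    simp only [zero_mulVec]
    split_ifs <;> first | omega | simp
  · simp only [mem_Icc]
    split_ifs <;> first
      | omega
      | (subst_vars; simp; done)
      | (subst_vars; rw [hnear (by omega) (by omega) (by omega) (by omega)]; simp)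

end Matrix

/-- If `H` is an `m×m` block tridiagonal matrix, `H u = f`, `B` is an
`m×m` block tridiagonal matrix agreeing with `H` on the extended layer `[a−1,b+1]`
and invertible, with `G_{j,k}` the `(j,k)` block of `B⁻¹`, then for every `a ≤ j ≤ b`
the global solution inside the layer is recovered by the discrete Green's
representation formula:
`u_j = Σ_{q=a}^{b} G_{j,q} f_q + G_{j,a−1} B_{a−1,a} u_a − G_{j,a} B_{a,a−1} u_{a−1}
      + G_{j,b+1} B_{b+1,b} u_b − G_{j,b} B_{b,b+1} u_{b+1}`. -/
theorem discrete_greens_representation_formula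
    (m n : ℕ) (H B : ℕ → ℕ → Matrix (Fin n) (Fin n) ℂ)
    (u f : ℕ → Fin n → ℂ)
    (htriH : ∀ p q, p < m → q < m → (p + 1 < q ∨ q + 1 < p) → H p q = 0)
    (htriB : ∀ p q, p < m → q < m → (p + 1 < q ∨ q + 1 < p) → B p q = 0)
    (hHu : ∀ p, p < m → ∑ q ∈ Finset.range m, H p q *ᵥ u q = f p)
    (a b : ℕ) (ha : 1 ≤ a) (hab : a ≤ b) (hb : b + 2 ≤ m)
    (hagree : ∀ p q, a - 1 ≤ p → p ≤ b + 1 → a - 1 ≤ q → q ≤ b + 1 → B p q = H p q)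
    (Bmat : Matrix (Fin m × Fin n) (Fin m × Fin n) ℂ)
    (hBmat : ∀ (p q : Fin m) (i j : Fin n), Bmat (p, i) (q, j) = B (p : ℕ) (q : ℕ) i j)
    (hinv : IsUnit Bmat)
    (G : ℕ → ℕ → Matrix (Fin n) (Fin n) ℂ)
    (hG : ∀ (p q : Fin m) (i j : Fin n), G (p : ℕ) (q : ℕ) i j = Bmat⁻¹ (p, i) (q, j)) :
    ∀ j, a ≤ j → j ≤ b →
      u j = (∑ q ∈ Finset.Icc a b, G j q *ᵥ f q)
        + G j (a - 1) *ᵥ (B (a - 1) a *ᵥ u a)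
        - G j a *ᵥ (B a (a - 1) *ᵥ u (a - 1))
        + G j (b + 1) *ᵥ (B (b + 1) b *ᵥ u b)
        - G j b *ᵥ (B b (b + 1) *ᵥ u (b + 1)) := by
  intro j haj hjb
  have hmul : Bmat⁻¹ * Bmat = 1 :=
    nonsing_inv_mul Bmat ((isUnit_iff_isUnit_det Bmat).1 hinv)
  have hrep := sum_block_mulVec_of_mul_eq_one hG hBmat hmul
    (fun q => if q ∈ Icc a b then u q else 0) (p := j) (by omega)
  have hrow : ∀ p ∈ range m, ∑ q ∈ range m, B p q *ᵥ (if q ∈ Icc a b then u q else 0) =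
      (if p ∈ Icc a b then f p else 0)
        + (if p = a - 1 then B (a - 1) a *ᵥ u a else 0)
        - (if p = a then B a (a - 1) *ᵥ u (a - 1) else 0)
        + (if p = b + 1 then B (b + 1) b *ᵥ u b else 0)
        - (if p = b then B b (b + 1) *ᵥ u (b + 1) else 0) := fun p hp => by
    rw [sum_congr rfl fun q hq => block_mulVec_truncate_layer htriH htriB ha hab hagree u
      (mem_range.1 hp) (mem_range.1 hq)]
    simp only [sum_add_distrib, sum_sub_distrib, sum_ite_irrel, sum_const_zero, sum_ite_eq',
      mem_range, hHu p (mem_range.1 hp), show a < m by omega, show a - 1 < m by omega,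
      show b < m by omega, show b + 1 < m by omega, if_true]
  have hsub : (range m).filter (· ∈ Icc a b) = Icc a b := by
    ext q
    simp only [mem_filter, mem_range, mem_Icc]
    omega
  rw [sum_congr rfl fun p hp => congrArg (G j p *ᵥ ·) (hrow p hp)] at hrep
  have hite : ∀ (c : Prop) [Decidable c] (p : ℕ) (x : Fin n → ℂ),
      G j p *ᵥ (if c then x else 0) = if c then G j p *ᵥ x else 0 := fun c _ p x => by
    split_ifs <;> simp
  simp only [mulVec_add, mulVec_sub, sum_add_distrib, sum_sub_distrib, hite, sum_ite_eq',
    mem_range, show a < m by omega, show a - 1 < m by omega, show b < m by omega,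
    show b + 1 < m by omega, if_true] at hrep
  rw [← sum_filter, hsub, if_pos (mem_Icc.2 ⟨haj, hjb⟩)] at hrep
  exact hrep.symm
end
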